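/- arXiv:2212.13549 — 2 statements merged into one kernel-verified Lean document; each statement's English description precedes it below -/
import Mathlib

section
/- Let (M,d) be a bounded metric space with uniform relative normal structure such that the family A(M) of admissible subsets is compact, and let T : M → M be an orbit-nonexpansive mapping. Then T has a fixed point. -/
open Metric Set

/-- The orbit of `x` under `T`: `{x} ∪ {Tⁿ x : n ≥ 1}`. -/
def orbitOf {M : Type*} (T : M → M) (x : M) : Set M :=
  Set.range fun n : ℕ => T^[n] x

/-- `D(x,A) = sup { d(x,a) : a ∈ A }`. -/
noncomputable def Dsup {M : Type*} [MetricSpace M] (x : M) (A : Set M) : ℝ :=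
  sSup (dist x '' A)

/-- A self-map `T` is orbit-nonexpansive if `d(Tx,Ty) ≤ D(x, o_T(y))` for all `x,y`. -/
def OrbitNonexpansive {M : Type*} [MetricSpace M] (T : M → M) : Prop :=
  ∀ x y : M, dist (T x) (T y) ≤ Dsup x (orbitOf T y)

/-- A set is admissible if it is an intersection of closed balls. -/
def Admissible {M : Type*} [MetricSpace M] (A : Set M) : Prop :=
  ∃ C : Set (M × ℝ), A = ⋂ p ∈ C, Metric.closedBall p.1 p.2

/-- The family of admissible sets is compact: any collection of admissible sets whose
finite subcollections have nonempty intersection has nonempty intersection. -/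
def AdmissibleCompact (M : Type*) [MetricSpace M] : Prop :=
  ∀ 𝒞 : Set (Set M), (∀ A ∈ 𝒞, Admissible A) →
    (∀ 𝒟 ⊆ 𝒞, 𝒟.Finite → (⋂₀ 𝒟).Nonempty) → (⋂₀ 𝒞).Nonempty

/-- Metric normal structure: every admissible set with more than one point contains a
point `z` with `D(z,A) < δ(A)`. -/
def MetricNormalStructure (M : Type*) [MetricSpace M] : Prop :=
  ∀ A : Set M, Admissible A → A.Nontrivial → ∃ z ∈ A, Dsup z A < Metric.diam A

/-- `D` is a one-local retract of `M`: any family of closed balls centered in `D` with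
nonempty intersection meets `D`. -/
def OneLocalRetract {M : Type*} [MetricSpace M] (D : Set M) : Prop :=
  ∀ C : Set (M × ℝ), (∀ p ∈ C, p.1 ∈ D) →
    (⋂ p ∈ C, Metric.closedBall p.1 p.2).Nonempty →
    ((⋂ p ∈ C, Metric.closedBall p.1 p.2) ∩ D).Nonempty

/-- A family `F` of self-maps is interlaced orbit-nonexpansive if
`d(Tx,Sy) ≤ sup { D(x, o_R(y)) : R ∈ F }` for all `T,S ∈ F` and `x,y ∈ M`. -/
def InterlacedFamily {M : Type*} [MetricSpace M] (F : Set (M → M)) : Prop :=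
  ∀ T ∈ F, ∀ S ∈ F, ∀ x y : M,
    dist (T x) (S y) ≤ sSup ((fun R => Dsup x (orbitOf R y)) '' F)

/-- `B[A,r] = ⋂_{x ∈ A} B̄(x,r)`. -/
def Bball {M : Type*} [MetricSpace M] (A : Set M) (r : ℝ) : Set M :=
  ⋂ x ∈ A, Metric.closedBall x r

/-- Uniform relative normal structure. -/
def UniformRelativeNormalStructure (M : Type*) [MetricSpace M] : Prop :=
  ∃ c : ℝ, 0 < c ∧ c < 1 ∧
    ∀ A : Set M, Admissible A → 0 < Metric.diam A →
      ∃ z : M, Dsup z A ≤ c * Metric.diam A ∧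
        ∀ x : M, Dsup x A ≤ c * Metric.diam A → dist x z ≤ c * Metric.diam A

section Admissible

variable {M : Type*} [MetricSpace M]

theorem admissible_closedBall (x : M) (r : ℝ) : Admissible (closedBall x r) :=
  ⟨{(x, r)}, by simp⟩

theorem admissible_univ : Admissible (univ : Set M) :=
  ⟨∅, by simp⟩

theorem admissible_sInter {S : Set (Set M)} (hS : ∀ A ∈ S, Admissible A) :
    Admissible (⋂₀ S) := by
  refine ⟨{p | ∃ A ∈ S, A ⊆ closedBall p.1 p.2}, Subset.antisymm ?_ ?_⟩
  · intro x hx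
    simp only [mem_iInter]
    rintro p ⟨A, hA, hAp⟩
    exact hAp (hx A hA)
  · intro x hx A hA
    obtain ⟨C, hC⟩ := hS A hA
    simp only [mem_iInter] at hx
    rw [hC]
    simp only [mem_iInter]
    intro p hp
    refine hx p ⟨A, hA, ?_⟩
    rw [hC]
    exact biInter_subset_of_mem hp

theorem Admissible.inter {A B : Set M} (hA : Admissible A) (hB : Admissible B) :
    Admissible (A ∩ B) := by
  rw [← sInter_pair]
  apply admissible_sInter
  rintro C (rfl | rfl)
  exacts [hA, hB]

theorem admissible_Bball (A : Set M) (r : ℝ) : Admissible (Bball A r) := by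
  rw [Bball, ← sInter_image]
  apply admissible_sInter
  rintro _ ⟨x, -, rfl⟩
  exact admissible_closedBall x r

theorem mem_Bball_iff {A : Set M} {r : ℝ} {x : M} :
    x ∈ Bball A r ↔ ∀ a ∈ A, dist x a ≤ r := by
  simp [Bball]

theorem Dsup_le_of_mem_Bball {A : Set M} (hA : A.Nonempty) {r : ℝ} {x : M}
    (hx : x ∈ Bball A r) : Dsup x A ≤ r := by
  refine csSup_le (hA.image _) ?_
  rintro _ ⟨a, ha, rfl⟩
  exact mem_Bball_iff.1 hx a ha

theorem dist_le_Dsup (hM : Bornology.IsBounded (univ : Set M)) {A : Set M} (x : M) {a : M}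
    (ha : a ∈ A) : dist x a ≤ Dsup x A := by
  refine le_csSup ⟨diam (univ : Set M), ?_⟩ (mem_image_of_mem _ ha)
  rintro _ ⟨b, -, rfl⟩
  exact dist_le_diam_of_mem hM (mem_univ _) (mem_univ _)

/-- A nonempty admissible set mapped into itself by `T`. -/
def InvariantAdmissible (T : M → M) (A : Set M) : Prop :=
  Admissible A ∧ A.Nonempty ∧ MapsTo T A A

/-- By compactness, every invariant admissible set contains a minimal one. -/
theorem InvariantAdmissible.exists_minimal_subset (hcompact : AdmissibleCompact M) {T : M → M}
    {K : Set M} (hK : InvariantAdmissible T K) :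
    ∃ A ⊆ K, Minimal (InvariantAdmissible T) A := by
  refine zorn_superset_nonempty {A | InvariantAdmissible T A} ?_ K hK
  intro 𝒞 h𝒞 hchain hne
  refine ⟨⋂₀ 𝒞, ⟨admissible_sInter fun A hA => (h𝒞 hA).1, ?_, ?_⟩,
    fun A hA => sInter_subset_of_mem hA⟩
  · refine hcompact 𝒞 (fun A hA => (h𝒞 hA).1) fun 𝒟 h𝒟 hfin => ?_
    rcases 𝒟.eq_empty_or_nonempty with rfl | hD
    · obtain ⟨A, hA⟩ := hne
      exact (h𝒞 hA).2.1.mono (by simp)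
    · obtain ⟨B, hB, hBmin⟩ := hfin.exists_minimal hD
      refine (h𝒞 (h𝒟 hB)).2.1.mono (subset_sInter fun C hC => ?_)
      rcases hchain.total (h𝒟 hB) (h𝒟 hC) with h | h
      · exact h
      · exact hBmin hC h
  · exact fun x hx A hA => (h𝒞 hA).2.2 (hx A hA)

namespace OrbitNonexpansive

variable {T : M → M}

theorem dist_map_le (hT : OrbitNonexpansive T) {A : Set M} (hA : MapsTo T A A) {r : ℝ} {x y : M}
    (hx : x ∈ Bball A r) (hy : y ∈ A) : dist (T x) (T y) ≤ r := by
  refine (hT x y).trans (Dsup_le_of_mem_Bball (range_nonempty _) (mem_Bball_iff.2 ?_))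
  rintro _ ⟨n, rfl⟩
  exact mem_Bball_iff.1 hx _ (hA.iterate n hy)

theorem mapsTo_Bball (hT : OrbitNonexpansive T) {A : Set M}
    (hA : Minimal (InvariantAdmissible T) A) (r : ℝ) : MapsTo T (Bball A r) (Bball A r) := by
  intro x hx
  obtain ⟨hadm, ⟨a, ha⟩, hmaps⟩ := hA.prop
  have hball : ∀ y ∈ A, T y ∈ A ∩ closedBall (T x) r := fun y hy =>
    ⟨hmaps hy, by rw [mem_closedBall']; exact hT.dist_map_le hmaps hx hy⟩
  have hsub : A ⊆ A ∩ closedBall (T x) r :=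
    hA.le_of_le ⟨hadm.inter (admissible_closedBall _ _), ⟨T a, hball a ha⟩,
      fun y hy => hball y hy.1⟩ inter_subset_left
  exact mem_Bball_iff.2 fun a ha => mem_closedBall'.1 (hsub ha).2

/-- An invariant admissible set `B` that lies within `r` of one of its points contains an
invariant admissible set all of whose points are within `r` of each other. -/
theorem exists_subset_Bball_self (hT : OrbitNonexpansive T) {B : Set M} (hB : Admissible B)
    (hmaps : MapsTo T B B) {z : M} {r : ℝ} (hzB : z ∈ B) (hz : z ∈ Bball B r) :
    ∃ K ⊆ B, InvariantAdmissible T K ∧ K ⊆ Bball K r := by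
  set S : Set (Set M) := {L | Admissible L ∧ z ∈ L ∧ MapsTo T L L}
  have hKB : ⋂₀ S ⊆ B := sInter_subset_of_mem ⟨hB, hzB, hmaps⟩
  have hKadm : Admissible (⋂₀ S) := admissible_sInter fun L hL => hL.1
  have hzK : z ∈ ⋂₀ S := fun L hL => hL.2.1
  have hKmaps : MapsTo T (⋂₀ S) (⋂₀ S) := fun x hx L hL => hL.2.2 (hx L hL)
  refine ⟨⋂₀ S, hKB, ⟨hKadm, ⟨z, hzK⟩, hKmaps⟩, ?_⟩
  generalize hK : ⋂₀ S = K at *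
  have hmin : ∀ L ∈ S, K ⊆ L := fun L hL => hK ▸ sInter_subset_of_mem hL
  refine (hmin (K ∩ Bball K r) ⟨hKadm.inter (admissible_Bball _ _), ⟨hzK, ?_⟩, ?_⟩).trans
    inter_subset_right
  · exact mem_Bball_iff.2 fun a ha => mem_Bball_iff.1 hz a (hKB ha)
  · rintro x ⟨hxK, hx⟩
    have hTx := hKmaps hxK
    have hsub : K ⊆ K ∩ closedBall (T x) r := by
      refine hmin _ ⟨hKadm.inter (admissible_closedBall _ _), ⟨hzK, ?_⟩, fun y hy =>
        ⟨hKmaps hy.1, ?_⟩⟩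
      · exact mem_closedBall.2 (mem_Bball_iff.1 hz _ (hKB hTx))
      · exact mem_closedBall'.2 (hT.dist_map_le hKmaps hx hy.1)
    exact ⟨hTx, mem_Bball_iff.2 fun a ha => mem_closedBall'.1 (hsub ha).2⟩

/-- If the minimal invariant admissible sets `A n` have diameters decaying geometrically and
consecutive ones are geometrically close, then `T` has a fixed point. -/
theorem exists_fixedPoint_of_geometric (hT : OrbitNonexpansive T)
    (hcompact : AdmissibleCompact M) {A : ℕ → Set M} (hA : ∀ n, InvariantAdmissible T (A n))
    {c δ : ℝ} (hc0 : 0 ≤ c) (hc1 : c < 1) (hδ : 0 ≤ δ)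
    (hself : ∀ n, A n ⊆ Bball (A n) (c ^ n * δ))
    (hsucc : ∀ n, A (n + 1) ⊆ Bball (A n) (c ^ n * δ)) : ∃ x, T x = x := by
  have hpos : 0 < 1 - c := sub_pos.2 hc1
  have hfar : ∀ k n, A (n + k) ⊆ Bball (A n) (c ^ n * δ / (1 - c)) := by
    intro k
    induction k with
    | zero =>
      intro n w hw
      refine mem_Bball_iff.2 fun a ha => (mem_Bball_iff.1 (hself n hw) a ha).trans ?_
      rw [le_div_iff₀ hpos]
      have : 0 ≤ c ^ n * δ := by positivity
      nlinarith
    | succ k ih =>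
      intro n w hw
      obtain ⟨b, hb⟩ := (hA (n + 1)).2.1
      refine mem_Bball_iff.2 fun a ha => ?_
      have h1 := mem_Bball_iff.1 (ih (n + 1) (by rwa [add_right_comm, add_assoc])) b hb
      have h2 := mem_Bball_iff.1 (hsucc n hb) a ha
      calc dist w a ≤ dist w b + dist b a := dist_triangle _ _ _
        _ ≤ c ^ (n + 1) * δ / (1 - c) + c ^ n * δ := add_le_add h1 h2
        _ = c ^ n * δ / (1 - c) := by field_simp; ring
  obtain ⟨x, hx⟩ : (⋂₀ range fun n => Bball (A n) (c ^ n * δ / (1 - c))).Nonempty := by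
    refine hcompact _ ?_ fun 𝒟 h𝒟 hfin => ?_
    · rintro _ ⟨n, rfl⟩
      exact admissible_Bball _ _
    · rw [← image_univ] at h𝒟
      obtain ⟨s, -, hs, rfl⟩ :=
        (exists_subset_image_finite_and (p := (𝒟 = ·))).1 ⟨𝒟, h𝒟, hfin, rfl⟩
      obtain ⟨N, hN⟩ := hs.bddAbove
      obtain ⟨w, hw⟩ := (hA N).2.1
      refine ⟨w, ?_⟩
      rintro _ ⟨n, hn, rfl⟩
      obtain ⟨k, rfl⟩ := Nat.exists_eq_add_of_le (hN hn)
      exact hfar k n hw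
  refine ⟨x, dist_le_zero.1 ?_⟩
  have hbound : ∀ n : ℕ, dist (T x) x ≤ 2 * (c ^ n * δ / (1 - c)) := by
    intro n
    have hxn := hx _ (mem_range_self n)
    obtain ⟨-, ⟨y, hy⟩, hmaps⟩ := hA n
    have h1 := hT.dist_map_le hmaps hxn hy
    have h2 := mem_Bball_iff.1 hxn _ (hmaps hy)
    linarith [dist_triangle_right (T x) x (T y)]
  have hlim := (((tendsto_pow_atTop_nhds_zero_of_lt_one hc0 hc1).mul_const δ).div_const
    (1 - c)).const_mul 2
  simp only [zero_mul, zero_div, mul_zero] at hlim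
  exact ge_of_tendsto' hlim hbound

end OrbitNonexpansive

end Admissible

theorem stmt9 {M : Type*} [MetricSpace M] [Nonempty M]
    (hM : Bornology.IsBounded (Set.univ : Set M))
    (hurns : UniformRelativeNormalStructure M)
    (hcompact : AdmissibleCompact M)
    (T : M → M) (hT : OrbitNonexpansive T) :
    ∃ x : M, T x = x := by
  obtain ⟨c, hc0, hc1, hc⟩ := hurns
  have hbdd : ∀ A : Set M, Bornology.IsBounded A := fun A => hM.subset (subset_univ A)
  by_contra! hfix
  have hstep : ∀ A : {A : Set M // Minimal (InvariantAdmissible T) A},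
      ∃ B : {A : Set M // Minimal (InvariantAdmissible T) A},
        B.1 ⊆ Bball A.1 (c * diam A.1) ∧ diam B.1 ≤ c * diam A.1 := by
    rintro ⟨A, hA⟩
    obtain ⟨hadm, ⟨a, ha⟩, hmaps⟩ := hA.prop
    have hdiam : 0 < diam A :=
      (dist_pos.2 (hfix a)).trans_le (dist_le_diam_of_mem (hbdd A) (hmaps ha) ha)
    obtain ⟨z, hzA, hz⟩ := hc A hadm hdiam
    obtain ⟨K, hKB, hK, hKK⟩ := hT.exists_subset_Bball_self (admissible_Bball A _)
      (hT.mapsTo_Bball hA (c * diam A)) (z := z) (r := c * diam A)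
      (mem_Bball_iff.2 fun a ha => (dist_le_Dsup hM z ha).trans hzA)
      (mem_Bball_iff.2 fun x hx => by
        rw [dist_comm]
        exact hz x (Dsup_le_of_mem_Bball ⟨a, ha⟩ hx))
    obtain ⟨B, hBK, hB⟩ := hK.exists_minimal_subset hcompact
    exact ⟨⟨B, hB⟩, hBK.trans hKB, diam_le_of_forall_dist_le (by positivity) fun x hx y hy =>
      mem_Bball_iff.1 (hKK (hBK hx)) y (hBK hy)⟩
  choose next hnear hdiam using hstep
  obtain ⟨A₀, -, hA₀⟩ := InvariantAdmissible.exists_minimal_subset hcompact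
    (T := T) ⟨admissible_univ, univ_nonempty, mapsTo_univ _ _⟩
  let A : ℕ → {A : Set M // Minimal (InvariantAdmissible T) A} := fun n => next^[n] ⟨A₀, hA₀⟩
  have hA : ∀ n, A (n + 1) = next (A n) := fun n => Function.iterate_succ_apply' _ _ _
  have hdec : ∀ n, diam (A n).1 ≤ c ^ n * diam A₀ := by
    intro n
    induction n with
    | zero => simp [A]
    | succ n ih =>
      rw [hA, pow_succ', mul_assoc]
      exact (hdiam _).trans (mul_le_mul_of_nonneg_left ih hc0.le)
  obtain ⟨x, hx⟩ := hT.exists_fixedPoint_of_geometric hcompact (A := fun n => (A n).1)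
    (fun n => (A n).2.prop) hc0.le hc1 diam_nonneg
    (fun n x hx => mem_Bball_iff.2 fun a ha =>
      (dist_le_diam_of_mem (hbdd _) hx ha).trans (hdec n))
    (fun n x hx => mem_Bball_iff.2 fun a ha => by
      simp only [hA] at hx
      refine (mem_Bball_iff.1 (hnear _ hx) a ha).trans (le_trans ?_ (hdec n))
      exact mul_le_of_le_one_left diam_nonneg hc1.le)
  exact hfix x hx
end

section
/- Let (M,d) be a bounded nonempty metric space such that the family A(M) of admissible subsets is compact, and let F be a family of self-maps of M. Then there exists a nonempty admissible set A₀ ⊆ M with T(A₀) ⊆ A₀ for all T ∈ F, which is minimal with respect to set inclusion among all nonempty admissible subsets of M invariant under every T ∈ F. -/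
open Metric Set

theorem Admissible.sInter {M : Type*} [MetricSpace M] {𝒞 : Set (Set M)}
    (h : ∀ A ∈ 𝒞, Admissible A) : Admissible (⋂₀ 𝒞) := by
  choose! C hC using h
  refine ⟨⋃ A ∈ 𝒞, C A, ?_⟩
  rw [sInter_eq_biInter, biInter_iUnion]
  simp only [biInter_iUnion]
  exact iInter₂_congr hC

theorem IsChain.sInter_nonempty_of_finite {α : Type*} [Nonempty α] {𝒟 : Set (Set α)}
    (hchain : IsChain (· ⊆ ·) 𝒟) (hfin : 𝒟.Finite) (hne : ∀ A ∈ 𝒟, A.Nonempty) :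
    (⋂₀ 𝒟).Nonempty := by
  rcases 𝒟.eq_empty_or_nonempty with rfl | h𝒟
  · simp
  · obtain ⟨A, hA⟩ := hfin.exists_minimal h𝒟
    refine (hne A hA.prop).mono (subset_sInter fun B hB => ?_)
    rcases hchain.total hA.prop hB with h | h
    · exact h
    · exact hA.le_of_le hB h

theorem stmt19 {M : Type*} [MetricSpace M] [Nonempty M]
    (hM : Bornology.IsBounded (Set.univ : Set M))
    (hcompact : AdmissibleCompact M)
    (F : Set (M → M)) :
    ∃ A₀ : Set M, Admissible A₀ ∧ A₀.Nonempty ∧ (∀ T ∈ F, T '' A₀ ⊆ A₀) ∧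
      ∀ B : Set M, Admissible B → B.Nonempty → (∀ T ∈ F, T '' B ⊆ B) →
        B ⊆ A₀ → B = A₀ := by
  obtain ⟨A₀, hmin⟩ := zorn_superset
    {A : Set M | Admissible A ∧ A.Nonempty ∧ ∀ T ∈ F, T '' A ⊆ A} fun c hc hchain => by
      refine ⟨⋂₀ c, ⟨.sInter fun A hA => (hc hA).1, ?_, fun T hT => ?_⟩,
        fun A hA => sInter_subset_of_mem hA⟩
      · exact hcompact c (fun A hA => (hc hA).1) fun 𝒟 h𝒟 hfin =>
          (hchain.mono h𝒟).sInter_nonempty_of_finite hfin fun A hA => (hc (h𝒟 hA)).2.1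
      · exact subset_sInter fun A hA =>
          (image_mono (sInter_subset_of_mem hA)).trans ((hc hA).2.2 T hT)
  obtain ⟨hadm, hne, hinv⟩ := hmin.prop
  exact ⟨A₀, hadm, hne, hinv, fun B hB hBne hBinv hBA =>
    hBA.antisymm (hmin.le_of_le ⟨hB, hBne, hBinv⟩ hBA)⟩
end
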